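/- (Case II is impossible) There is no point x* ∈ Δ^7 with F†(x*) = α† such that f_7(x*) = f_8(x*) = α† and f_j(x*) < α† for every j ∈ {1,2,3,4,5,6}. -/

import Mathlib

noncomputable def sigD (t : ℝ) : ℝ := (1 - t) / t

def DeltaSeven : Set (Fin 8 → ℝ) := {x | (∀ i, 0 < x i) ∧ ∑ i, x i = 1}

noncomputable def fD (x : Fin 8 → ℝ) : Fin 8 → ℝ :=
  ![sigD (x 3 + x 4 + x 5) * sigD (x 0),
    sigD (x 3 + x 4 + x 5 + x 6 + x 7) * sigD (x 1),
    sigD (x 0 + x 1 + x 2 + x 6 + x 7) * sigD (x 2),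
    sigD (x 0 + x 1 + x 2) * sigD (x 3),
    sigD (x 0 + x 1 + x 2 + x 6 + x 7) * sigD (x 4),
    sigD (x 3 + x 4 + x 5 + x 6 + x 7) * sigD (x 5),
    sigD (x 3 + x 4 + x 5) * sigD (x 6),
    sigD (x 0 + x 1 + x 2) * sigD (x 7)]

noncomputable def FD (x : Fin 8 → ℝ) : ℝ :=
  Finset.univ.sup' Finset.univ_nonempty (fD x)

noncomputable def alphaD : ℝ := sInf (FD '' DeltaSeven)

open Filter Topology in
theorem cont_aux (x : Fin 8 → ℝ) (hx : x ∈ DeltaSeven) (j : Fin 8) :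
    ContinuousAt (fun y => fD y j) x := by
  obtain ⟨hp, -⟩ := hx
  have h0 := hp 0
  have h1 := hp 1
  have h2 := hp 2
  have h3 := hp 3
  have h4 := hp 4
  have h5 := hp 5
  have h6 := hp 6
  have h7 := hp 7
  have key : ∀ g h : (Fin 8 → ℝ) → ℝ, Continuous g → Continuous h → 0 < g x → 0 < h x →
      ContinuousAt (fun y => sigD (g y) * sigD (h y)) x := by
    intro g h hg hh pg ph
    unfold sigD
    exact ((continuousAt_const.sub hg.continuousAt).div hg.continuousAt pg.ne').mul
      ((continuousAt_const.sub hh.continuousAt).div hh.continuousAt ph.ne')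
  fin_cases j
  · exact key (fun x => x 3 + x 4 + x 5) (fun x => x 0) (by fun_prop) (by fun_prop)
      (by positivity) (by positivity)
  · exact key (fun x => x 3 + x 4 + x 5 + x 6 + x 7) (fun x => x 1) (by fun_prop) (by fun_prop)
      (by positivity) (by positivity)
  · exact key (fun x => x 0 + x 1 + x 2 + x 6 + x 7) (fun x => x 2) (by fun_prop) (by fun_prop)
      (by positivity) (by positivity)
  · exact key (fun x => x 0 + x 1 + x 2) (fun x => x 3) (by fun_prop) (by fun_prop)
      (by positivity) (by positivity)
  · exact key (fun x => x 0 + x 1 + x 2 + x 6 + x 7) (fun x => x 4) (by fun_prop) (by fun_prop)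
      (by positivity) (by positivity)
  · exact key (fun x => x 3 + x 4 + x 5 + x 6 + x 7) (fun x => x 5) (by fun_prop) (by fun_prop)
      (by positivity) (by positivity)
  · exact key (fun x => x 3 + x 4 + x 5) (fun x => x 6) (by fun_prop) (by fun_prop)
      (by positivity) (by positivity)
  · exact key (fun x => x 0 + x 1 + x 2) (fun x => x 7) (by fun_prop) (by fun_prop)
      (by positivity) (by positivity)

open Filter Topology in
theorem step_aux (x : Fin 8 → ℝ) (hx : x ∈ DeltaSeven) (v : Fin 8 → ℝ) (hv : ∑ i, v i = 0)
    (a : ℝ) : ∃ t : ℝ, 0 < t ∧ t < 1 ∧ (fun i => x i + t * v i) ∈ DeltaSeven ∧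
      ∀ j, fD x j < a → fD (fun i => x i + t * v i) j < a := by
  have hc : Continuous (fun t : ℝ => (fun i => x i + t * v i : Fin 8 → ℝ)) := by fun_prop
  have hc0 : (fun i => x i + (0:ℝ) * v i : Fin 8 → ℝ) = x := by simp
  have ht : Tendsto (fun t : ℝ => (fun i => x i + t * v i : Fin 8 → ℝ)) (𝓝 0) (𝓝 x) := by
    have := hc.tendsto 0
    rwa [hc0] at this
  have e1 : ∀ᶠ y in 𝓝 x, (∀ i, 0 < y i) ∧ ∀ j, fD x j < a → fD y j < a := by
    refine Filter.Eventually.and ?_ ?_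
    · rw [eventually_all]
      intro i
      exact (continuous_apply i).continuousAt.eventually (lt_mem_nhds (hx.1 i))
    · rw [eventually_all]
      intro j
      by_cases hj : fD x j < a
      · filter_upwards [(cont_aux x hx j).eventually (gt_mem_nhds hj)] with y hy _ using hy
      · exact Eventually.of_forall fun y h => absurd h hj
  have e2 := (ht.eventually e1).filter_mono (nhdsWithin_le_nhds (s := Set.Ioi 0))
  obtain ⟨t, ⟨h1, h2⟩, h3, h4⟩ := (e2.and (Ioo_mem_nhdsGT (zero_lt_one' ℝ))).exists
  refine ⟨t, h3, h4, ⟨h1, ?_⟩, h2⟩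
  rw [Finset.sum_add_distrib, ← Finset.mul_sum, hv, hx.2]
  simp

theorem sum_aux {x : Fin 8 → ℝ} (hx : x ∈ DeltaSeven) :
    x 0 + x 1 + x 2 + x 3 + x 4 + x 5 + x 6 + x 7 = 1 := by
  have := hx.2
  simpa [Fin.sum_univ_eight] using this

theorem sig_lt {s t : ℝ} (hs : 0 < s) (h : s < t) : sigD t < sigD s := by
  unfold sigD
  rw [div_lt_div_iff₀ (by linarith) hs]
  nlinarith

theorem sig_pos {s : ℝ} (hs : 0 < s) (h : s < 1) : 0 < sigD s := by
  unfold sigD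
  exact div_pos (by linarith) hs

theorem prod_aux {b c bb cc : ℝ} (hb : 0 < b) (hc : 0 < c) (hbb : 0 < bb) (hcc : 0 < cc)
    (hs : b + c = bb + cc) (h1 : b + c < 1) (h : b * c < bb * cc) :
    sigD bb * sigD cc < sigD b * sigD c := by
  unfold sigD
  rw [div_mul_div_comm, div_mul_div_comm, div_lt_div_iff₀ (by positivity) (by positivity)]
  have e1 : (1 - bb) * (1 - cc) = (1 - (b + c)) + bb * cc := by rw [hs]; ring
  have e2 : (1 - b) * (1 - c) = (1 - (b + c)) + b * c := by ring
  rw [e1, e2]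
  nlinarith [mul_pos (sub_pos.2 h1) (sub_pos.2 h)]

theorem quad_aux {d t : ℝ} (b : ℝ) (hd : d ≠ 0) (t0 : 0 < t) (t1 : t < 1) :
    b * (d + b) < (b + t * d) * (d + b - t * d) := by
  have h : 0 < 1 - t := by linarith
  have h2 : 0 < t * (1 - t) * d ^ 2 := by positivity
  have h3 : (b + t * d) * (d + b - t * d) = b * (d + b) + t * (1 - t) * d ^ 2 := by ring
  linarith

theorem f_pos {x : Fin 8 → ℝ} (hx : x ∈ DeltaSeven) : 0 < fD x 6 := by
  have hs := sum_aux hx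
  have hp := hx.1
  change 0 < sigD (x 3 + x 4 + x 5) * sigD (x 6)
  have h0 := hp 0
  have h1 := hp 1
  have h2 := hp 2
  have h3 := hp 3
  have h4 := hp 4
  have h5 := hp 5
  have h6 := hp 6
  have h7 := hp 7
  exact mul_pos (sig_pos (by linarith) (by linarith)) (sig_pos (by linarith) (by linarith))

theorem no_better {y : Fin 8 → ℝ} (hy : y ∈ DeltaSeven) (h : ∀ j, fD y j < alphaD) : False := by
  have h1 : alphaD ≤ FD y := by
    refine csInf_le ⟨0, ?_⟩ ⟨y, hy, rfl⟩
    rintro _ ⟨z, hz, rfl⟩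
    exact (f_pos hz).le.trans (Finset.le_sup' (fD z) (Finset.mem_univ 6))
  have h2 : FD y < alphaD := by
    unfold FD
    rw [Finset.sup'_lt_iff]
    exact fun j _ => h j
  linarith

set_option maxHeartbeats 1000000 in
theorem stmt8 :
    ¬ ∃ x ∈ DeltaSeven, FD x = alphaD ∧
      fD x 6 = alphaD ∧ fD x 7 = alphaD ∧
      fD x 0 < alphaD ∧ fD x 1 < alphaD ∧ fD x 2 < alphaD ∧
      fD x 3 < alphaD ∧ fD x 4 < alphaD ∧ fD x 5 < alphaD := by
  rintro ⟨x, hx, -, g6, g7, g0, g1, g2, g3, g4, g5⟩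
  have hs := sum_aux hx
  have h0 := hx.1 0
  have h1 := hx.1 1
  have h2 := hx.1 2
  have h3 := hx.1 3
  have h4 := hx.1 4
  have h5 := hx.1 5
  have h6 := hx.1 6
  have h7 := hx.1 7
  have a1 : x 6 < x 0 := by
    by_contra hcon
    have hle : sigD (x 6) ≤ sigD (x 0) := by
      rcases (not_lt.1 hcon).lt_or_eq with h | h
      · exact (sig_lt h0 h).le
      · rw [h]
    have hB : 0 < sigD (x 3 + x 4 + x 5) := sig_pos (by linarith) (by linarith)
    change sigD (x 3 + x 4 + x 5) * sigD (x 6) = _ at g6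
    change sigD (x 3 + x 4 + x 5) * sigD (x 0) < _ at g0
    have := mul_le_mul_of_nonneg_left hle hB.le
    linarith
  have a2 : x 7 < x 3 := by
    by_contra hcon
    have hle : sigD (x 7) ≤ sigD (x 3) := by
      rcases (not_lt.1 hcon).lt_or_eq with h | h
      · exact (sig_lt h3 h).le
      · rw [h]
    have hB : 0 < sigD (x 0 + x 1 + x 2) := sig_pos (by linarith) (by linarith)
    change sigD (x 0 + x 1 + x 2) * sigD (x 7) = _ at g7
    change sigD (x 0 + x 1 + x 2) * sigD (x 3) < _ at g3
    have := mul_le_mul_of_nonneg_left hle hB.le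
    linarith
  by_cases hB : x 6 = x 3 + x 4 + x 5
  · -- then the eighth coordinate differs from the first block sum
    have hA : x 7 - (x 0 + x 1 + x 2) ≠ 0 := by
      intro h
      linarith
    set d := x 7 - (x 0 + x 1 + x 2) with hd
    obtain ⟨t, t0, t1, hy, hj⟩ := step_aux x hx ![d, 0, 0, 0, 0, 0, 0, -d]
      (by simp [Fin.sum_univ_eight]) alphaD
    set y : Fin 8 → ℝ := fun i => x i + t * (![d, 0, 0, 0, 0, 0, 0, -d] : Fin 8 → ℝ) i with hyd
    have y0 : y 0 = x 0 + t * d := by simp [hyd]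
    have y1 : y 1 = x 1 := by simp [hyd]
    have y2 : y 2 = x 2 := by simp [hyd]
    have y3 : y 3 = x 3 := by simp [hyd]
    have y4 : y 4 = x 4 := by simp [hyd]
    have y5 : y 5 = x 5 := by simp [hyd]
    have y6 : y 6 = x 6 := by simp [hyd]
    have y7 : y 7 = x 7 - t * d := by simp [hyd]; ring
    clear_value y
    have k6 : fD y 6 = alphaD := by
      rw [← g6]
      change sigD (y 3 + y 4 + y 5) * sigD (y 6) = sigD (x 3 + x 4 + x 5) * sigD (x 6)
      rw [y3, y4, y5, y6]
    have k7 : fD y 7 < alphaD := by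
      rw [← g7]
      change sigD (y 0 + y 1 + y 2) * sigD (y 7) < sigD (x 0 + x 1 + x 2) * sigD (x 7)
      have p0 := hy.1 0
      have p1 := hy.1 1
      have p2 := hy.1 2
      have p7 := hy.1 7
      refine prod_aux (by linarith) h7 (by linarith) p7 (by linarith) (by linarith) ?_
      rw [y0, y1, y2, y7]
      have e : x 7 = d + (x 0 + x 1 + x 2) := by rw [hd]; ring
      have q := quad_aux (x 0 + x 1 + x 2) hA t0 t1
      rw [← e] at q
      have ee : x 0 + t * d + x 1 + x 2 = x 0 + x 1 + x 2 + t * d := by ring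
      rw [ee]
      exact q
    obtain ⟨s, s0, s1, hz, hk⟩ := step_aux y hy ![0, 0, 0, 0, 0, 0, 1, -1]
      (by simp [Fin.sum_univ_eight]) alphaD
    refine no_better hz ?_
    intro j
    by_cases hj6 : j = 6
    · subst hj6
      rw [← k6]
      have hyS := sum_aux hy
      have q := hy.1
      have hBp : 0 < sigD (y 3 + y 4 + y 5) :=
        sig_pos (by linarith [q 3, q 4, q 5]) (by linarith [q 0, q 1, q 2, q 6, q 7])
      have hl : sigD (y 6 + s) < sigD (y 6) := sig_lt (q 6) (by linarith)
      have := mul_lt_mul_of_pos_left hl hBp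
      simpa [fD] using this
    · apply hk
      fin_cases j
      · exact hj 0 g0
      · exact hj 1 g1
      · exact hj 2 g2
      · exact hj 3 g3
      · exact hj 4 g4
      · exact hj 5 g5
      · exact absurd rfl hj6
      · exact k7
  · have hA : x 6 - (x 3 + x 4 + x 5) ≠ 0 := by
      intro h
      exact hB (by linarith)
    set d := x 6 - (x 3 + x 4 + x 5) with hd
    obtain ⟨t, t0, t1, hy, hj⟩ := step_aux x hx ![0, 0, 0, d, 0, 0, -d, 0]
      (by simp [Fin.sum_univ_eight]) alphaD
    set y : Fin 8 → ℝ := fun i => x i + t * (![0, 0, 0, d, 0, 0, -d, 0] : Fin 8 → ℝ) i with hyd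
    have y0 : y 0 = x 0 := by simp [hyd]
    have y1 : y 1 = x 1 := by simp [hyd]
    have y2 : y 2 = x 2 := by simp [hyd]
    have y3 : y 3 = x 3 + t * d := by simp [hyd]
    have y4 : y 4 = x 4 := by simp [hyd]
    have y5 : y 5 = x 5 := by simp [hyd]
    have y6 : y 6 = x 6 - t * d := by simp [hyd]; ring
    have y7 : y 7 = x 7 := by simp [hyd]
    clear_value y
    have k7 : fD y 7 = alphaD := by
      rw [← g7]
      change sigD (y 0 + y 1 + y 2) * sigD (y 7) = sigD (x 0 + x 1 + x 2) * sigD (x 7)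
      rw [y0, y1, y2, y7]
    have k6 : fD y 6 < alphaD := by
      rw [← g6]
      change sigD (y 3 + y 4 + y 5) * sigD (y 6) < sigD (x 3 + x 4 + x 5) * sigD (x 6)
      have p3 := hy.1 3
      have p4 := hy.1 4
      have p5 := hy.1 5
      have p6 := hy.1 6
      refine prod_aux (by linarith) h6 (by linarith) p6 (by linarith) (by linarith) ?_
      rw [y3, y4, y5, y6]
      have e : x 6 = d + (x 3 + x 4 + x 5) := by rw [hd]; ring
      have q := quad_aux (x 3 + x 4 + x 5) hA t0 t1
      rw [← e] at q
      have ee : x 3 + t * d + x 4 + x 5 = x 3 + x 4 + x 5 + t * d := by ring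
      rw [ee]
      exact q
    obtain ⟨s, s0, s1, hz, hk⟩ := step_aux y hy ![0, 0, 0, 0, 0, 0, -1, 1]
      (by simp [Fin.sum_univ_eight]) alphaD
    refine no_better hz ?_
    intro j
    by_cases hj7 : j = 7
    · subst hj7
      rw [← k7]
      have hyS := sum_aux hy
      have q := hy.1
      have hBp : 0 < sigD (y 0 + y 1 + y 2) :=
        sig_pos (by linarith [q 0, q 1, q 2]) (by linarith [q 3, q 4, q 5, q 6, q 7])
      have hl : sigD (y 7 + s) < sigD (y 7) := sig_lt (q 7) (by linarith)
      have := mul_lt_mul_of_pos_left hl hBp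
      simpa [fD] using this
    · apply hk
      fin_cases j
      · exact hj 0 g0
      · exact hj 1 g1
      · exact hj 2 g2
      · exact hj 3 g3
      · exact hj 4 g4
      · exact hj 5 g5
      · exact k6
      · exact absurd rfl hj7
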